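/- Let $\tilde{n}_0 \le \cdots \le \tilde{n}_N$ and $\tilde{n}'_0 \le \cdots \le \tilde{n}'_{N'}$ be two minimal forms (i.e., for each, no strict reduction satisfying the reduction inequality $k(\tilde{n}_{k+1}+1) \ge \sum_{l=0}^{k}\tilde{n}_l$ exists for any $k < N$, resp. $k < N'$). If the two resulting coefficient sequences coincide, i.e. $\tilde{n}_0 = \tilde{n}'_0$ and $c_i = c'_i$ for all $i = 1, \ldots, \tilde{n}_0$ (with $c_i = 1-i+\min_{k \le N}\lfloor(\sum_{l=0}^k \tilde{n}_l - i)/k\rfloor$ and similarly $c'_i$), then $N = N'$ and $\tilde{n}_i = \tilde{n}'_i$ for all $i$. -/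

import Mathlib

open Finset in
/-- An integer lies below the minimum of the floored quotients exactly when it lies below each
of the quotients. -/
theorem le_inf'_fdiv_iff {N : ℕ} (hN : 1 ≤ N) (s : ℕ → ℤ) (i v : ℤ) :
    v ≤ (Icc 1 N).inf' (nonempty_Icc.mpr hN) (fun k => Int.fdiv (s k - i) (k : ℤ)) ↔
      ∀ k, 1 ≤ k → k ≤ N → i + k * v ≤ s k := by
  simp only [le_inf'_iff, mem_Icc, and_imp]
  refine forall_congr' fun k => forall_congr' fun hk => forall_congr' fun _ => ?_
  rw [Int.fdiv_eq_ediv_of_nonneg _ (Int.natCast_nonneg k), Int.le_ediv_iff_mul_le (by omega),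
    mul_comm]
  omega

/-- A sequence that is nondecreasing on `{0, …, N}` is monotone there. -/
theorem le_of_forall_le_succ_of_le {N : ℕ} {n : ℕ → ℤ} (hmono : ∀ l, l < N → n l ≤ n (l + 1))
    {a b : ℕ} (hab : a ≤ b) (hb : b ≤ N) : n a ≤ n b := by
  induction b, hab using Nat.le_induction with
  | base => exact le_rfl
  | succ b _ ih => exact (ih (by omega)).trans (hmono b (by omega))

/-- If `n` crosses the level `v` at the index `m`, then the partial sums of `n l - v` are
minimal at `m`. -/
theorem sum_range_sub_mul_le {N m : ℕ} {n : ℕ → ℤ} {v : ℤ}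
    (hle : ∀ l, l ≤ m → n l ≤ v) (hge : ∀ l, m < l → l ≤ N → v ≤ n l) {k : ℕ} (hk : k ≤ N) :
    (∑ l ∈ Finset.range (m + 1), n l) - m * v ≤ (∑ l ∈ Finset.range (k + 1), n l) - k * v := by
  rcases le_total k m with hkm | hmk
  · clear hge
    induction m, hkm using Nat.le_induction with
    | base => exact le_rfl
    | succ m hkm ih =>
      have hstep := hle (m + 1) le_rfl
      have := ih fun l hl => hle l (by omega)
      rw [Finset.sum_range_succ _ (m + 1)]
      push_cast
      linarith
  · induction k, hmk using Nat.le_induction with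
    | base => exact le_rfl
    | succ k hmk ih =>
      have hstep := hge (k + 1) (by omega) hk
      have := ih (by omega)
      rw [Finset.sum_range_succ _ (k + 1)]
      push_cast
      linarith

/-- Two dimension vectors with the same level sets of coefficients cannot first differ at an
index `m + 1` where `n` satisfies the minimality inequality and `n'` is larger or has ended. -/
theorem not_first_difference {N N' m : ℕ} {n n' : ℕ → ℤ}
    (hpos : 0 < n 0)
    (hmono : ∀ l, l < N → n l ≤ n (l + 1)) (hmono' : ∀ l, l < N' → n' l ≤ n' (l + 1))
    (hminimal : ∀ k, 1 ≤ k → k < N →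
      (k : ℤ) * (n (k + 1) + 1) < ∑ l ∈ Finset.range (k + 1), n l)
    (hlevel : ∀ i : ℤ, 1 ≤ i → i ≤ n 0 → ∀ v : ℤ,
      (∀ k : ℕ, 1 ≤ k → k ≤ N → i + k * v ≤ ∑ l ∈ Finset.range (k + 1), n l) ↔
      ∀ k : ℕ, 1 ≤ k → k ≤ N' → i + k * v ≤ ∑ l ∈ Finset.range (k + 1), n' l)
    (hm : m < N) (heq : ∀ l, l ≤ m → n l = n' l)
    (hlt : m < N' → n (m + 1) < n' (m + 1)) : False := by
  set v := n (m + 1) + 1 with hv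
  set i := (∑ l ∈ Finset.range (m + 1), n l) - m * v with hi
  have hsum : ∑ l ∈ Finset.range (m + 1), n l = ∑ l ∈ Finset.range (m + 1), n' l :=
    Finset.sum_congr rfl fun l hl => heq l (by simp at hl; omega)
  have hle : ∀ l, l ≤ m → n l ≤ v := fun l hl => by
    have := le_of_forall_le_succ_of_le hmono (show l ≤ m + 1 by omega) hm
    omega
  have hi_pos : 1 ≤ i := by
    rcases Nat.eq_zero_or_pos m with rfl | h
    · simp [hi]; omega
    · have := hminimal m h hm
      rw [← hv] at this
      omega
  have hi_le : i ≤ n 0 := by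
    have := sum_range_sub_mul_le (N := m) (k := 0) hle (fun l h h' => by omega) (Nat.zero_le _)
    simpa [hi] using this
  have key := (hlevel i hi_pos hi_le v).2 fun k _ hk => by
    have := sum_range_sub_mul_le (n := n') (m := m) (v := v) (fun l hl => heq l hl ▸ hle l hl)
      (fun l hl hlN => by
        have h1 := hlt (by omega)
        have h2 := le_of_forall_le_succ_of_le hmono' (show m + 1 ≤ l by omega) hlN
        omega) hk
    linarith
  have := key (m + 1) (by omega) hm
  rw [Finset.sum_range_succ _ (m + 1)] at this
  push_cast at this
  linarith


/-- The DMT equivalence class of a Rayleigh product channel is uniquely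
identified by its minimal form: two minimal ordered dimension vectors with the same
smallest entry and the same coefficient sequence `c_i` on `1 ≤ i ≤ ñ₀` must be equal. -/
theorem rp_minimal_form_unique (N N' : ℕ) (hN : 1 ≤ N) (hN' : 1 ≤ N')
    (n n' : ℕ → ℤ)
    (hpos : ∀ l, l ≤ N → 0 < n l)
    (hmono : ∀ l, l < N → n l ≤ n (l + 1))
    (hpos' : ∀ l, l ≤ N' → 0 < n' l)
    (hmono' : ∀ l, l < N' → n' l ≤ n' (l + 1))
    -- minimality: no strict reduction exists
    (hminimal : ∀ k, 1 ≤ k → k < N →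
      (k : ℤ) * (n (k + 1) + 1) < ∑ l ∈ Finset.range (k + 1), n l)
    (hminimal' : ∀ k, 1 ≤ k → k < N' →
      (k : ℤ) * (n' (k + 1) + 1) < ∑ l ∈ Finset.range (k + 1), n' l)
    (h0 : n 0 = n' 0)
    (hcc : ∀ i : ℤ, 1 ≤ i → i ≤ n 0 →
      (1 - i + (Finset.Icc 1 N).inf' (Finset.nonempty_Icc.mpr hN)
          (fun k => Int.fdiv ((∑ l ∈ Finset.range (k + 1), n l) - i) (k : ℤ)))
        = (1 - i + (Finset.Icc 1 N').inf' (Finset.nonempty_Icc.mpr hN')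
          (fun k => Int.fdiv ((∑ l ∈ Finset.range (k + 1), n' l) - i) (k : ℤ)))) :
    N = N' ∧ ∀ i, i ≤ N → n i = n' i := by
  have hlevel : ∀ i : ℤ, 1 ≤ i → i ≤ n 0 → ∀ v : ℤ,
      (∀ k : ℕ, 1 ≤ k → k ≤ N → i + k * v ≤ ∑ l ∈ Finset.range (k + 1), n l) ↔
      ∀ k : ℕ, 1 ≤ k → k ≤ N' → i + k * v ≤ ∑ l ∈ Finset.range (k + 1), n' l := by
    intro i h1 h2 v
    rw [← le_inf'_fdiv_iff hN (fun k => ∑ l ∈ Finset.range (k + 1), n l),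
      ← le_inf'_fdiv_iff hN' (fun k => ∑ l ∈ Finset.range (k + 1), n' l),
      add_left_cancel (hcc i h1 h2)]
  have hlevel' : ∀ i : ℤ, 1 ≤ i → i ≤ n' 0 → ∀ v : ℤ,
      (∀ k : ℕ, 1 ≤ k → k ≤ N' → i + k * v ≤ ∑ l ∈ Finset.range (k + 1), n' l) ↔
      ∀ k : ℕ, 1 ≤ k → k ≤ N → i + k * v ≤ ∑ l ∈ Finset.range (k + 1), n l :=
    fun i h1 h2 v => (hlevel i h1 (h0 ▸ h2) v).symm
  have no_diff := fun m => not_first_difference (m := m) (hpos 0 (Nat.zero_le _)) hmono hmono'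
    hminimal hlevel
  have no_diff' := fun m => not_first_difference (m := m) (hpos' 0 (Nat.zero_le _)) hmono' hmono
    hminimal' hlevel'
  have agree : ∀ m, m ≤ N → m ≤ N' → ∀ l, l ≤ m → n l = n' l := by
    intro m
    induction m with
    | zero =>
      intro _ _ l hl
      rwa [Nat.le_zero.mp hl]
    | succ m ih =>
      intro hm hm' l hl
      have hprev := ih (by omega) (by omega)
      rcases Nat.le_succ_iff.mp hl with h | rfl
      · exact hprev l h
      · rcases lt_trichotomy (n (m + 1)) (n' (m + 1)) with h | h | h
        · exact (no_diff m hm hprev fun _ => h).elim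
        · exact h
        · exact (no_diff' m hm' (fun l hl => (hprev l hl).symm) fun _ => h).elim
  rcases lt_trichotomy N N' with h | rfl | h
  · exact (no_diff' N h (fun l hl => (agree N le_rfl h.le l hl).symm) fun h => by omega).elim
  · exact ⟨rfl, agree N le_rfl le_rfl⟩
  · exact (no_diff N' h (agree N' h.le le_rfl) fun h => by omega).elim
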